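/- The function P(x) = max_{y ∈ ℝᵐ} f(x,y) is twice differentiable with ∇²P(x) = H(x, y*(x)) for all x, where y*(x) = argmax_y f(x,y), and the Hessian map x ↦ ∇²P(x) is Lipschitz continuous in operator norm with constant L₂ = ρ(1+κ)³, where κ = ℓ/μ. -/

import Mathlib

noncomputable section

open RealInnerProductSpace

/-- `ℝⁿ` as a Euclidean space. -/
abbrev En (n : ℕ) := EuclideanSpace ℝ (Fin n)

/-- The point `(x, y)` in the Euclidean (ℓ²) product `ℝⁿ × ℝᵐ`. -/
def pair {n m : ℕ} (x : En n) (y : En m) : WithLp 2 (En n × En m) :=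
  (WithLp.equiv 2 (En n × En m)).symm (x, y)

/-- Partial gradient `∇ₓ f(x, y)` with respect to the first variable. -/
def gradx {n m : ℕ} (f : WithLp 2 (En n × En m) → ℝ) (x : En n) (y : En m) : En n :=
  gradient (fun x' => f (pair x' y)) x

/-- Partial gradient `∇_y f(x, y)` with respect to the second variable. -/
def grady {n m : ℕ} (f : WithLp 2 (En n × En m) → ℝ) (x : En n) (y : En m) : En m :=
  gradient (fun y' => f (pair x y')) y

/-- Second-order partial derivative `∇²ₓₓ f(x, y)`. -/
def Hxx {n m : ℕ} (f : WithLp 2 (En n × En m) → ℝ) (x : En n) (y : En m) : En n →L[ℝ] En n :=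
  fderiv ℝ (fun x' => gradx f x' y) x

/-- Second-order partial derivative `∇²ₓ_y f(x, y)`. -/
def Hxy {n m : ℕ} (f : WithLp 2 (En n × En m) → ℝ) (x : En n) (y : En m) : En m →L[ℝ] En n :=
  fderiv ℝ (fun y' => gradx f x y') y

/-- Second-order partial derivative `∇²_yₓ f(x, y)`. -/
def Hyx {n m : ℕ} (f : WithLp 2 (En n × En m) → ℝ) (x : En n) (y : En m) : En n →L[ℝ] En m :=
  fderiv ℝ (fun x' => grady f x' y) x

/-- Second-order partial derivative `∇²_y_y f(x, y)`. -/
def Hyy {n m : ℕ} (f : WithLp 2 (En n × En m) → ℝ) (x : En n) (y : En m) : En m →L[ℝ] En m :=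
  fderiv ℝ (fun y' => grady f x y') y

/-- `H(x,y) = ∇²ₓₓf(x,y) − ∇²ₓ_yf(x,y) (∇²_y_yf(x,y))⁻¹ ∇²_yₓf(x,y)`. -/
def Hmat {n m : ℕ} (f : WithLp 2 (En n × En m) → ℝ) (x : En n) (y : En m) : En n →L[ℝ] En n :=
  Hxx f x y - (Hxy f x y).comp (((Hyy f x y).inverse).comp (Hyx f x y))

/-- `P(x) = max_y f(x, y)` (as a supremum over `y`). -/
def Pmax {n m : ℕ} (f : WithLp 2 (En n × En m) → ℝ) (x : En n) : ℝ := ⨆ y, f (pair x y)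

/-- The Hessian of `P` at `x`, as the derivative of the gradient map. -/
def hessP {n : ℕ} (P : En n → ℝ) (x : En n) : En n →L[ℝ] En n := fderiv ℝ (gradient P) x

section GeneralLemmas

open Filter Topology Asymptotics

variable {E F G : Type*} [NormedAddCommGroup E] [InnerProductSpace ℝ E]
  [NormedAddCommGroup F] [NormedSpace ℝ F] [NormedAddCommGroup G] [NormedSpace ℝ G]

/-- A strongly concave function lies below its tangent paraboloids. -/
theorem StrongConcaveOn.le_tangent_paraboloid [CompleteSpace E] {g : E → ℝ} {μ : ℝ}
    (hg : StrongConcaveOn Set.univ μ g) {x g' : E} (h : HasGradientAt g g' x) (y : E) :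
    g y ≤ g x + ⟪g', y - x⟫ - μ / 2 * ‖y - x‖ ^ 2 := by
  have hderiv : HasDerivAt (fun t : ℝ => g (x + t • (y - x))) ⟪g', y - x⟫ 0 := by
    have hline : HasDerivAt (fun t : ℝ => x + t • (y - x)) (y - x) 0 := by
      simpa using ((hasDerivAt_id (0 : ℝ)).smul_const (y - x)).const_add x
    have hg' : HasFDerivAt g (InnerProductSpace.toDual ℝ E g') (x + (0 : ℝ) • (y - x)) := by
      simpa using h.hasFDerivAt
    exact hg'.comp_hasDerivAt (0 : ℝ) hline
  have hslope := hderiv.tendsto_slope_zero_right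
  have hlower : Tendsto (fun t : ℝ => g y - g x + (1 - t) * (μ / 2 * ‖y - x‖ ^ 2)) (𝓝[>] 0)
      (𝓝 (g y - g x + (1 - 0) * (μ / 2 * ‖y - x‖ ^ 2))) :=
    ((by fun_prop : Continuous fun t : ℝ =>
      g y - g x + (1 - t) * (μ / 2 * ‖y - x‖ ^ 2)).tendsto 0).mono_left nhdsWithin_le_nhds
  have hle := le_of_tendsto_of_tendsto hlower hslope (by
    filter_upwards [Ioo_mem_nhdsGT (zero_lt_one' ℝ)] with t ht
    have hconc := hg.2 (Set.mem_univ x) (Set.mem_univ y) (sub_nonneg.2 ht.2.le) ht.1.le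
      (sub_add_cancel 1 t)
    rw [show (1 - t) • x + t • y = x + t • (y - x) by module, norm_sub_rev x y] at hconc
    simp only [smul_eq_mul] at hconc
    simp only [zero_add, zero_smul, add_zero, smul_eq_mul]
    rw [← div_eq_inv_mul, le_div_iff₀ ht.1]
    linarith)
  linarith

/-- The gradient of a strongly concave function is strongly monotone decreasing. -/
theorem StrongConcaveOn.inner_gradient_sub_le [CompleteSpace E] {g : E → ℝ} {μ : ℝ}
    (hg : StrongConcaveOn Set.univ μ g) (hd : Differentiable ℝ g) (y z : E) :
    ⟪gradient g y - gradient g z, y - z⟫ ≤ -(μ * ‖y - z‖ ^ 2) := by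
  have hyz := hg.le_tangent_paraboloid (hd y).hasGradientAt z
  have hzy := hg.le_tangent_paraboloid (hd z).hasGradientAt y
  rw [← neg_sub y z, inner_neg_right, norm_neg] at hyz
  rw [inner_sub_left]
  linarith

theorem StrongConcaveOn.exists_forall_ge [FiniteDimensional ℝ E] {g : E → ℝ} {μ : ℝ}
    (hg : StrongConcaveOn Set.univ μ g) (hμ : 0 < μ) (hd : Differentiable ℝ g) :
    ∃ x, ∀ y, g y ≤ g x := by
  have : CompleteSpace E := FiniteDimensional.complete ℝ E
  have : ProperSpace E := FiniteDimensional.proper_real E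
  refine hd.continuous.exists_forall_ge' 0 ?_
  filter_upwards [(tendsto_norm_cocompact_atTop (E := E)).eventually_ge_atTop
    (2 * ‖gradient g 0‖ / μ)] with y hy
  have htan := hg.le_tangent_paraboloid (hd 0).hasGradientAt y
  have hcs := real_inner_le_norm (gradient g 0) y
  rw [div_le_iff₀ hμ] at hy
  rw [sub_zero] at htan
  nlinarith [norm_nonneg y]

/-- The derivative of a strongly monotone decreasing map is uniformly negative definite. -/
theorem HasFDerivAt.inner_le_of_strongly_decreasing {T : E → E} {A : E →L[ℝ] E} {z : E} {μ : ℝ}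
    (hA : HasFDerivAt T A z)
    (hT : ∀ y, ⟪T y - T z, y - z⟫ ≤ -(μ * ‖y - z‖ ^ 2)) (v : E) :
    ⟪A v, v⟫ ≤ -(μ * ‖v‖ ^ 2) := by
  have hderiv : HasDerivAt (fun t : ℝ => T (z + t • v)) (A v) 0 := by
    have hline : HasDerivAt (fun t : ℝ => z + t • v) v 0 := by
      simpa using ((hasDerivAt_id (0 : ℝ)).smul_const v).const_add z
    have hA' : HasFDerivAt T A (z + (0 : ℝ) • v) := by simpa using hA
    exact hA'.comp_hasDerivAt (0 : ℝ) hline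
  refine le_of_tendsto (hderiv.tendsto_slope_zero_right.inner tendsto_const_nhds) ?_
  filter_upwards [self_mem_nhdsWithin] with t ht
  have ht : 0 < t := ht
  have hTt := hT (z + t • v)
  simp only [add_sub_cancel_left, inner_smul_right, norm_smul, Real.norm_eq_abs, mul_pow,
    sq_abs] at hTt
  simp only [zero_add, zero_smul, add_zero, real_inner_smul_left]
  rw [← div_eq_inv_mul, div_le_iff₀ ht]
  nlinarith

/-- A negative definite operator on a finite-dimensional space is invertible, with a bound on the
inverse. -/
theorem ContinuousLinearMap.exists_equiv_of_inner_le [FiniteDimensional ℝ E] {A : E →L[ℝ] E}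
    {μ : ℝ} (hμ : 0 < μ) (hA : ∀ v, ⟪A v, v⟫ ≤ -(μ * ‖v‖ ^ 2)) :
    ∃ e : E ≃L[ℝ] E, (e : E →L[ℝ] E) = A ∧ ‖(e.symm : E →L[ℝ] E)‖ ≤ 1 / μ := by
  have hbound : ∀ v, μ * ‖v‖ ≤ ‖A v‖ := by
    intro v
    have hcs := abs_le.1 (abs_real_inner_le_norm (A v) v)
    rcases (norm_nonneg v).eq_or_lt with hv | hv
    · simp [← hv]
    · nlinarith [hA v]
  have hinj : Function.Injective (A : E →ₗ[ℝ] E) := by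
    rw [← LinearMap.ker_eq_bot, LinearMap.ker_eq_bot']
    intro v hv
    have hv' : A v = 0 := hv
    have := hbound v
    rw [hv', norm_zero] at this
    exact norm_le_zero_iff.1 (by nlinarith [norm_nonneg v])
  let e := (LinearEquiv.ofInjectiveEndo (A : E →ₗ[ℝ] E) hinj).toContinuousLinearEquiv
  have heA : (e : E →L[ℝ] E) = A := by ext v; rfl
  refine ⟨e, heA, ContinuousLinearMap.opNorm_le_bound _ (by positivity) fun w => ?_⟩
  have h := hbound (e.symm w)
  rw [← heA, ContinuousLinearEquiv.coe_coe, e.apply_symm_apply] at h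
  rw [ContinuousLinearEquiv.coe_coe, one_div, ← div_eq_inv_mul, le_div_iff₀ hμ]
  linarith

/-- Inversion is Lipschitz on operators with bounded inverses. -/
theorem ContinuousLinearEquiv.norm_symm_sub_symm_le (e e' : F ≃L[ℝ] G) :
    ‖(e.symm : G →L[ℝ] F) - e'.symm‖ ≤
      ‖(e.symm : G →L[ℝ] F)‖ * ‖(e : F →L[ℝ] G) - e'‖ * ‖(e'.symm : G →L[ℝ] F)‖ := by
  have h : (e.symm : G →L[ℝ] F) - e'.symm =
      -((e.symm : G →L[ℝ] F).comp (((e : F →L[ℝ] G) - e').comp (e'.symm : G →L[ℝ] F))) := by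
    ext w
    simp
  rw [h, norm_neg, mul_assoc]
  exact (ContinuousLinearMap.opNorm_comp_le _ _).trans
    (mul_le_mul_of_nonneg_left (ContinuousLinearMap.opNorm_comp_le _ _) (norm_nonneg _))

/-- The derivative of a function of two variables is assembled from its partial derivatives. -/
theorem DifferentiableAt.hasFDerivAt_coprod {E₁ E₂ : Type*} [NormedAddCommGroup E₁]
    [NormedSpace ℝ E₁] [NormedAddCommGroup E₂] [NormedSpace ℝ E₂] {Φ : E₁ × E₂ → G} {x : E₁}
    {y : E₂} (h : DifferentiableAt ℝ Φ (x, y)) :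
    HasFDerivAt Φ ((fderiv ℝ (fun x' => Φ (x', y)) x).coprod
      (fderiv ℝ (fun y' => Φ (x, y')) y)) (x, y) := by
  have hx : fderiv ℝ (fun x' => Φ (x', y)) x =
      (fderiv ℝ Φ (x, y)).comp (ContinuousLinearMap.inl ℝ E₁ E₂) :=
    (h.hasFDerivAt.comp x (hasFDerivAt_prodMk_left x y)).fderiv
  have hy : fderiv ℝ (fun y' => Φ (x, y')) y =
      (fderiv ℝ Φ (x, y)).comp (ContinuousLinearMap.inr ℝ E₁ E₂) :=
    (h.hasFDerivAt.comp y (hasFDerivAt_prodMk_right x y)).fderiv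
  rw [hx, hy]
  convert h.hasFDerivAt using 1
  ext <;> simp

/-- Implicit differentiation along a Lipschitz branch of zeros. -/
theorem HasFDerivAt.implicit_of_lipschitz {E₁ E₂ : Type*} [NormedAddCommGroup E₁]
    [NormedSpace ℝ E₁] [NormedAddCommGroup E₂] [NormedSpace ℝ E₂] {Φ : E₁ × E₂ → G}
    {u : E₁ → E₂} {x : E₁} {A : E₁ →L[ℝ] G} {e : E₂ ≃L[ℝ] G} {K : ℝ}
    (hΦ : HasFDerivAt Φ (A.coprod (e : E₂ →L[ℝ] G)) (x, u x))
    (hu : ∀ x', ‖u x' - u x‖ ≤ K * ‖x' - x‖) (hzero : ∀ x', Φ (x', u x') = 0) :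
    HasFDerivAt u (-((e.symm : G →L[ℝ] E₂).comp A)) x := by
  have huO : (fun x' => u x' - u x) =O[𝓝 x] fun x' => x' - x :=
    IsBigO.of_bound K (Eventually.of_forall hu)
  have hsub : Tendsto (fun x' : E₁ => x' - x) (𝓝 x) (𝓝 0) :=
    tendsto_sub_nhds_zero_iff.2 tendsto_id
  have hucont : Tendsto u (𝓝 x) (𝓝 (u x)) := by
    simpa using (huO.trans_tendsto hsub).add_const (u x)
  have hpair : Tendsto (fun x' => (x', u x')) (𝓝 x) (𝓝 (x, u x)) :=
    tendsto_id.prodMk_nhds hucont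
  have hpairO : (fun x' => (x', u x') - (x, u x)) =O[𝓝 x] fun x' => x' - x :=
    (isBigO_refl _ _).prod_left huO
  have ho := (hΦ.isLittleO.comp_tendsto hpair).trans_isBigO hpairO
  have ho' := ((e.symm : G →L[ℝ] E₂).isBigO_comp _ (𝓝 x)).trans_isLittleO ho
  refine HasFDerivAt.of_isLittleO (ho'.neg_left.congr_left fun x' => ?_)
  simp [hzero]
  abel

end GeneralLemmas

section Pair

variable {n m : ℕ}

theorem pair_sub_pair (x x' : En n) (y y' : En m) :
    pair x y - pair x' y' = pair (x - x') (y - y') := rfl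

theorem norm_pair_sq (x : En n) (y : En m) : ‖pair x y‖ ^ 2 = ‖x‖ ^ 2 + ‖y‖ ^ 2 :=
  WithLp.prod_norm_sq_eq_of_L2 _

theorem norm_pair_zero_right (x : En n) : ‖pair x (0 : En m)‖ = ‖x‖ := by
  have h := norm_pair_sq x (0 : En m)
  rw [norm_zero, zero_pow two_ne_zero, add_zero] at h
  exact (sq_eq_sq₀ (norm_nonneg _) (norm_nonneg _)).1 h

theorem norm_pair_zero_left (y : En m) : ‖pair (0 : En n) y‖ = ‖y‖ := by
  have h := norm_pair_sq (0 : En n) y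
  rw [norm_zero, zero_pow two_ne_zero, zero_add] at h
  exact (sq_eq_sq₀ (norm_nonneg _) (norm_nonneg _)).1 h

theorem norm_pair_le (x : En n) (y : En m) : ‖pair x y‖ ≤ ‖x‖ + ‖y‖ := by
  refine le_of_sq_le_sq ?_ (by positivity)
  rw [norm_pair_sq]
  nlinarith [mul_nonneg (norm_nonneg x) (norm_nonneg y)]

theorem norm_withLp_fst_le (p : WithLp 2 (En n × En m)) : ‖p.fst‖ ≤ ‖p‖ := by
  refine le_of_sq_le_sq ?_ (norm_nonneg _)
  rw [WithLp.prod_norm_sq_eq_of_L2]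
  exact le_add_of_nonneg_right (sq_nonneg _)

theorem norm_withLp_snd_le (p : WithLp 2 (En n × En m)) : ‖p.snd‖ ≤ ‖p‖ := by
  refine le_of_sq_le_sq ?_ (norm_nonneg _)
  rw [WithLp.prod_norm_sq_eq_of_L2]
  exact le_add_of_nonneg_left (sq_nonneg _)

theorem hasFDerivAt_pair (z : En n × En m) :
    HasFDerivAt (fun z : En n × En m => pair z.1 z.2)
      ((WithLp.prodContinuousLinearEquiv 2 ℝ (En n) (En m)).symm :
        En n × En m →L[ℝ] WithLp 2 (En n × En m)) z :=
  (WithLp.prodContinuousLinearEquiv 2 ℝ (En n) (En m)).symm.hasFDerivAt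

theorem inner_pair (p : WithLp 2 (En n × En m)) (v : En n) (w : En m) :
    ⟪p, pair v w⟫ = ⟪p.fst, v⟫ + ⟪p.snd, w⟫ :=
  WithLp.prod_inner_apply _ _

variable {f : WithLp 2 (En n × En m) → ℝ}

theorem hasFDerivAt_comp_pair (hf : Differentiable ℝ f) (x : En n) (y : En m) :
    HasFDerivAt (fun z : En n × En m => f (pair z.1 z.2))
      ((InnerProductSpace.toDual ℝ (En n) (gradient f (pair x y)).fst).coprod
        (InnerProductSpace.toDual ℝ (En m) (gradient f (pair x y)).snd)) (x, y) := by
  have hgrad : HasFDerivAt f _ (pair x y) := (hf (pair x y)).hasGradientAt.hasFDerivAt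
  refine (hgrad.comp (x, y) (hasFDerivAt_pair (x, y))).congr_fderiv ?_
  exact ContinuousLinearMap.ext fun z => inner_pair _ z.1 z.2

theorem hasGradientAt_pair_left (hf : Differentiable ℝ f) (x : En n) (y : En m) :
    HasGradientAt (fun x' => f (pair x' y)) (gradient f (pair x y)).fst x := by
  rw [hasGradientAt_iff_hasFDerivAt]
  refine ((hasFDerivAt_comp_pair hf x y).comp x
    (hasFDerivAt_prodMk_left (𝕜 := ℝ) x y)).congr_fderiv ?_
  exact ContinuousLinearMap.ext fun v => by simp

theorem hasGradientAt_pair_right (hf : Differentiable ℝ f) (x : En n) (y : En m) :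
    HasGradientAt (fun y' => f (pair x y')) (gradient f (pair x y)).snd y := by
  rw [hasGradientAt_iff_hasFDerivAt]
  refine ((hasFDerivAt_comp_pair hf x y).comp y
    (hasFDerivAt_prodMk_right (𝕜 := ℝ) x y)).congr_fderiv ?_
  exact ContinuousLinearMap.ext fun v => by simp

theorem gradx_eq_fst (hf : Differentiable ℝ f) (x : En n) (y : En m) :
    gradx f x y = (gradient f (pair x y)).fst :=
  (hasGradientAt_pair_left hf x y).gradient

theorem grady_eq_snd (hf : Differentiable ℝ f) (x : En n) (y : En m) :
    grady f x y = (gradient f (pair x y)).snd :=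
  (hasGradientAt_pair_right hf x y).gradient

theorem differentiable_gradient (hf : ContDiff ℝ 2 f) : Differentiable ℝ (gradient f) :=
  (InnerProductSpace.toDual ℝ (WithLp 2 (En n × En m))).symm.differentiable.comp
    ((hf.fderiv_right (m := 1) (by norm_num)).differentiable one_ne_zero)

theorem differentiable_ofLp_gradient_pair (hf : ContDiff ℝ 2 f) :
    Differentiable ℝ fun z : En n × En m =>
      WithLp.prodContinuousLinearEquiv 2 ℝ (En n) (En m) (gradient f (pair z.1 z.2)) :=
  (WithLp.prodContinuousLinearEquiv 2 ℝ (En n) (En m)).differentiable.comp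
    ((differentiable_gradient hf).comp fun z => (hasFDerivAt_pair z).differentiableAt)

theorem hasFDerivAt_gradx (hf : ContDiff ℝ 2 f) (x : En n) (y : En m) :
    HasFDerivAt (fun z : En n × En m => gradx f z.1 z.2) ((Hxx f x y).coprod (Hxy f x y))
      (x, y) := by
  have h : Differentiable ℝ fun z : En n × En m => gradx f z.1 z.2 := by
    simp only [gradx_eq_fst (hf.differentiable two_ne_zero)]
    exact (differentiable_ofLp_gradient_pair hf).fst
  exact (h (x, y)).hasFDerivAt_coprod

theorem hasFDerivAt_grady (hf : ContDiff ℝ 2 f) (x : En n) (y : En m) :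
    HasFDerivAt (fun z : En n × En m => grady f z.1 z.2) ((Hyx f x y).coprod (Hyy f x y))
      (x, y) := by
  have h : Differentiable ℝ fun z : En n × En m => grady f z.1 z.2 := by
    simp only [grady_eq_snd (hf.differentiable two_ne_zero)]
    exact (differentiable_ofLp_gradient_pair hf).snd
  exact (h (x, y)).hasFDerivAt_coprod

section Bounds

variable {ℓ μ : ℝ}

theorem norm_Hxy_le (hf : Differentiable ℝ f) (hℓ : 0 ≤ ℓ)
    (hlip : ∀ p q : WithLp 2 (En n × En m), ‖gradient f p - gradient f q‖ ≤ ℓ * ‖p - q‖)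
    (x : En n) (y : En m) : ‖Hxy f x y‖ ≤ ℓ := by
  refine norm_fderiv_le_of_lip' ℝ hℓ (Filter.Eventually.of_forall fun y' => ?_)
  rw [gradx_eq_fst hf, gradx_eq_fst hf, ← WithLp.sub_fst]
  refine (norm_withLp_fst_le _).trans ((hlip _ _).trans_eq ?_)
  rw [pair_sub_pair, sub_self, norm_pair_zero_left]

theorem norm_grady_sub_le (hf : Differentiable ℝ f)
    (hlip : ∀ p q : WithLp 2 (En n × En m), ‖gradient f p - gradient f q‖ ≤ ℓ * ‖p - q‖)
    (x x' : En n) (y : En m) : ‖grady f x y - grady f x' y‖ ≤ ℓ * ‖x - x'‖ := by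
  rw [grady_eq_snd hf, grady_eq_snd hf, ← WithLp.sub_snd]
  refine (norm_withLp_snd_le _).trans ((hlip _ _).trans_eq ?_)
  rw [pair_sub_pair, sub_self, norm_pair_zero_right]

theorem norm_Hyx_le (hf : Differentiable ℝ f) (hℓ : 0 ≤ ℓ)
    (hlip : ∀ p q : WithLp 2 (En n × En m), ‖gradient f p - gradient f q‖ ≤ ℓ * ‖p - q‖)
    (x : En n) (y : En m) : ‖Hyx f x y‖ ≤ ℓ :=
  norm_fderiv_le_of_lip' ℝ hℓ
    (Filter.Eventually.of_forall fun x' => norm_grady_sub_le hf hlip x' x y)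

theorem inner_grady_sub_le (hf : Differentiable ℝ f)
    (hconc : ∀ x : En n, StrongConcaveOn Set.univ μ (fun y => f (pair x y)))
    (x : En n) (y z : En m) :
    ⟪grady f x y - grady f x z, y - z⟫ ≤ -(μ * ‖y - z‖ ^ 2) :=
  (hconc x).inner_gradient_sub_le
    (fun y => (hasGradientAt_pair_right hf x y).differentiableAt) y z

theorem exists_equiv_Hyy (hf : ContDiff ℝ 2 f) (hμ : 0 < μ)
    (hconc : ∀ x : En n, StrongConcaveOn Set.univ μ (fun y => f (pair x y)))
    (x : En n) (y : En m) :
    ∃ e : En m ≃L[ℝ] En m, (e : En m →L[ℝ] En m) = Hyy f x y ∧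
      ‖(e.symm : En m →L[ℝ] En m)‖ ≤ 1 / μ := by
  have hd : HasFDerivAt (fun y' => grady f x y') (Hyy f x y) y :=
    ((hasFDerivAt_grady hf x y).comp y
      (hasFDerivAt_prodMk_right x y)).differentiableAt.hasFDerivAt
  exact ContinuousLinearMap.exists_equiv_of_inner_le hμ fun v =>
    hd.inner_le_of_strongly_decreasing
      (fun z => inner_grady_sub_le (hf.differentiable two_ne_zero) hconc x z y) v

/-- The maximizer of `f(x, ·)` depends on `x` in an `ℓ/μ`-Lipschitz way. -/
theorem norm_argmax_sub_le (hf : Differentiable ℝ f) (hμ : 0 < μ)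
    (hlip : ∀ p q : WithLp 2 (En n × En m), ‖gradient f p - gradient f q‖ ≤ ℓ * ‖p - q‖)
    (hconc : ∀ x : En n, StrongConcaveOn Set.univ μ (fun y => f (pair x y)))
    {u : En n → En m} (hu : ∀ x, grady f x (u x) = 0) (x x' : En n) :
    ‖u x - u x'‖ ≤ ℓ / μ * ‖x - x'‖ := by
  have hmono := inner_grady_sub_le hf hconc x (u x) (u x')
  have hcs := real_inner_le_norm (grady f x (u x')) (u x - u x')
  have hG := norm_grady_sub_le hf hlip x x' (u x')
  rw [hu, zero_sub, inner_neg_left] at hmono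
  rw [hu, sub_zero] at hG
  rw [div_mul_eq_mul_div, le_div_iff₀ hμ]
  rcases (norm_nonneg (u x - u x')).eq_or_lt with h | h
  · rw [← h, zero_mul]
    exact (norm_nonneg _).trans hG
  · refine le_of_mul_le_mul_right ?_ h
    nlinarith [mul_le_mul_of_nonneg_right hG h.le]

/-- If the second partial derivatives at two points differ by at most `δ`, then the values of `H`
differ by at most `δ (1 + ℓ/μ)²`. -/
theorem norm_Hmat_sub_le (hf : ContDiff ℝ 2 f) (hμ : 0 < μ) (hℓ : 0 ≤ ℓ)
    (hlip : ∀ p q : WithLp 2 (En n × En m), ‖gradient f p - gradient f q‖ ≤ ℓ * ‖p - q‖)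
    (hconc : ∀ x : En n, StrongConcaveOn Set.univ μ (fun y => f (pair x y)))
    {x x' : En n} {y y' : En m} {δ : ℝ}
    (hxx : ‖Hxx f x y - Hxx f x' y'‖ ≤ δ) (hxy : ‖Hxy f x y - Hxy f x' y'‖ ≤ δ)
    (hyx : ‖Hyx f x y - Hyx f x' y'‖ ≤ δ) (hyy : ‖Hyy f x y - Hyy f x' y'‖ ≤ δ) :
    ‖Hmat f x y - Hmat f x' y'‖ ≤ δ * (1 + ℓ / μ) ^ 2 := by
  have hd := hf.differentiable two_ne_zero
  have hδ : 0 ≤ δ := (norm_nonneg _).trans hxx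
  obtain ⟨e, he, hen⟩ := exists_equiv_Hyy hf hμ hconc x y
  obtain ⟨e', he', hen'⟩ := exists_equiv_Hyy hf hμ hconc x' y'
  have hB := norm_Hxy_le hd hℓ hlip x' y'
  have hD := norm_Hyx_le hd hℓ hlip x y
  have hC : ‖(e.symm : En m →L[ℝ] En m) - e'.symm‖ ≤ 1 / μ * δ * (1 / μ) := by
    refine (e.norm_symm_sub_symm_le e').trans ?_
    rw [he, he']
    gcongr
  have hsplit : Hmat f x y - Hmat f x' y' = (Hxx f x y - Hxx f x' y')
      - ((Hxy f x y - Hxy f x' y').comp ((e.symm : En m →L[ℝ] En m).comp (Hyx f x y))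
        + (Hxy f x' y').comp (((e.symm : En m →L[ℝ] En m) - e'.symm).comp (Hyx f x y))
        + (Hxy f x' y').comp
            ((e'.symm : En m →L[ℝ] En m).comp (Hyx f x y - Hyx f x' y'))) := by
    rw [Hmat, Hmat, ← he, ← he', ContinuousLinearMap.inverse_equiv,
      ContinuousLinearMap.inverse_equiv]
    simp only [ContinuousLinearMap.comp_sub, ContinuousLinearMap.sub_comp]
    abel
  have hcomp : ∀ (B : En m →L[ℝ] En n) (C : En m →L[ℝ] En m) (D : En n →L[ℝ] En m) (b c d : ℝ),
      ‖B‖ ≤ b → ‖C‖ ≤ c → ‖D‖ ≤ d → ‖B.comp (C.comp D)‖ ≤ b * (c * d) := by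
    intro B C D b c d hb hc hd
    have hb0 := (norm_nonneg B).trans hb
    have hc0 := (norm_nonneg C).trans hc
    refine (ContinuousLinearMap.opNorm_comp_le _ _).trans ?_
    gcongr
    refine (ContinuousLinearMap.opNorm_comp_le _ _).trans ?_
    gcongr
  rw [hsplit]
  calc _ ≤ δ + (δ * (1 / μ * ℓ) + ℓ * (1 / μ * δ * (1 / μ) * ℓ) + ℓ * (1 / μ * δ)) :=
        norm_sub_le_of_le hxx (norm_add_le_of_le (norm_add_le_of_le
          (hcomp _ _ _ _ _ _ hxy hen hD) (hcomp _ _ _ _ _ _ hB hC hD))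
          (hcomp _ _ _ _ _ _ hB hen' hyx))
    _ = δ * (1 + ℓ / μ) ^ 2 := by ring

end Bounds

end Pair

/-- `P(x) = max_y f(x,y)` is twice differentiable with
`∇²P(x) = H(x, y*(x))`, and `x ↦ ∇²P(x)` is Lipschitz continuous in operator norm with
constant `L₂ = ρ(1+κ)³`, where `κ = ℓ/μ` and `y*(x)` is the maximizer of `f(x, ·)`. -/
theorem statement3 {n m : ℕ} (f : WithLp 2 (En n × En m) → ℝ) (ℓ μ ρ : ℝ)
    (hμ : 0 < μ) (hμℓ : μ ≤ ℓ)
    (hf : ContDiff ℝ 2 f)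
    (hlip : ∀ p q : WithLp 2 (En n × En m), ‖gradient f p - gradient f q‖ ≤ ℓ * ‖p - q‖)
    (hxx : ∀ (x x' : En n) (y y' : En m),
      ‖Hxx f x y - Hxx f x' y'‖ ≤ ρ * ‖pair x y - pair x' y'‖)
    (hxy : ∀ (x x' : En n) (y y' : En m),
      ‖Hxy f x y - Hxy f x' y'‖ ≤ ρ * ‖pair x y - pair x' y'‖)
    (hyx : ∀ (x x' : En n) (y y' : En m),
      ‖Hyx f x y - Hyx f x' y'‖ ≤ ρ * ‖pair x y - pair x' y'‖)
    (hyy : ∀ (x x' : En n) (y y' : En m),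
      ‖Hyy f x y - Hyy f x' y'‖ ≤ ρ * ‖pair x y - pair x' y'‖)
    (hconc : ∀ x : En n, StrongConcaveOn Set.univ μ (fun y => f (pair x y))) :
    ∃ ystar : En n → En m,
      (∀ (x : En n) (y : En m), f (pair x y) ≤ f (pair x (ystar x))) ∧
      Differentiable ℝ (Pmax f) ∧
      Differentiable ℝ (gradient (Pmax f)) ∧
      (∀ x : En n, hessP (Pmax f) x = Hmat f x (ystar x)) ∧
      (∀ x x' : En n,
        ‖hessP (Pmax f) x - hessP (Pmax f) x'‖ ≤ ρ * (1 + ℓ / μ) ^ 3 * ‖x - x'‖) := by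
  have hd : Differentiable ℝ f := hf.differentiable two_ne_zero
  have hℓ : 0 ≤ ℓ := hμ.le.trans hμℓ
  choose u hu using fun x => (hconc x).exists_forall_ge hμ
    fun y => (hasGradientAt_pair_right hd x y).differentiableAt
  have hP : Pmax f = fun x => f (pair x (u x)) := by
    funext x
    exact le_antisymm (ciSup_le (hu x)) (le_ciSup ⟨_, Set.forall_mem_range.2 (hu x)⟩ (u x))
  have hcrit : ∀ x, grady f x (u x) = 0 := by
    intro x
    have hmax : IsLocalMax (fun y => f (pair x y)) (u x) := Filter.Eventually.of_forall (hu x)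
    rw [grady, gradient, hmax.fderiv_eq_zero, map_zero]
  have hulip := norm_argmax_sub_le hd hμ hlip hconc hcrit
  have huderiv : ∀ x, HasFDerivAt u
      (-((Hyy f x (u x)).inverse.comp (Hyx f x (u x)))) x := by
    intro x
    obtain ⟨e, he, -⟩ := exists_equiv_Hyy hf hμ hconc x (u x)
    have hG := hasFDerivAt_grady hf x (u x)
    rw [← he] at hG ⊢
    rw [ContinuousLinearMap.inverse_equiv]
    exact hG.implicit_of_lipschitz (fun x' => hulip x' x) hcrit
  have hgraph : ∀ x, HasFDerivAt (fun x => (x, u x)) ((ContinuousLinearMap.id ℝ (En n)).prod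
      (-((Hyy f x (u x)).inverse.comp (Hyx f x (u x))))) x :=
    fun x => (hasFDerivAt_id x).prodMk (huderiv x)
  have hgrad : ∀ x, HasGradientAt (Pmax f) (gradx f x (u x)) x := by
    intro x
    rw [hasGradientAt_iff_hasFDerivAt, hP, gradx_eq_fst hd]
    refine ((hasFDerivAt_comp_pair hd x (u x)).comp x (hgraph x)).congr_fderiv ?_
    rw [← grady_eq_snd hd, hcrit]
    exact ContinuousLinearMap.ext fun v => by simp
  have hgradEq : gradient (Pmax f) = fun x => gradx f x (u x) := gradient_eq hgrad
  have hhess : ∀ x, HasFDerivAt (gradient (Pmax f)) (Hmat f x (u x)) x := by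
    intro x
    rw [hgradEq]
    refine ((hasFDerivAt_gradx hf x (u x)).comp x (hgraph x)).congr_fderiv ?_
    exact ContinuousLinearMap.ext fun v => by simp [Hmat, sub_eq_add_neg]
  refine ⟨u, hu, fun x => (hgrad x).differentiableAt, fun x => (hhess x).differentiableAt,
    fun x => (hhess x).fderiv, fun x x' => ?_⟩
  rw [hessP, hessP, (hhess x).fderiv, (hhess x').fderiv]
  rcases eq_or_ne x x' with rfl | hne
  · simp
  have hpair : ‖pair x (u x) - pair x' (u x')‖ ≤ (1 + ℓ / μ) * ‖x - x'‖ := by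
    rw [pair_sub_pair]
    linarith [norm_pair_le (x - x') (u x - u x'), hulip x x']
  have hρ : 0 ≤ ρ := by
    have h := (norm_nonneg _).trans (hxx x x' 0 0)
    rw [pair_sub_pair, sub_self, norm_pair_zero_right] at h
    exact nonneg_of_mul_nonneg_left h (norm_pos_iff.2 (sub_ne_zero.2 hne))
  have hκ : 0 ≤ ℓ / μ := by positivity
  calc _ ≤ ρ * ‖pair x (u x) - pair x' (u x')‖ * (1 + ℓ / μ) ^ 2 :=
        norm_Hmat_sub_le hf hμ hℓ hlip hconc (hxx _ _ _ _) (hxy _ _ _ _) (hyx _ _ _ _)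
          (hyy _ _ _ _)
    _ ≤ ρ * ((1 + ℓ / μ) * ‖x - x'‖) * (1 + ℓ / μ) ^ 2 := by gcongr
    _ = ρ * (1 + ℓ / μ) ^ 3 * ‖x - x'‖ := by ring
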